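/- arXiv:1411.2078 — 2 statements merged into one kernel-verified Lean document; each statement's English description precedes it below -/
import Mathlib

section
/- For every τ in the complex upper half-plane, the functions f(τ) = θ₂(2τ)θ₂(6τ), g(τ) = θ₃(2τ)θ₃(6τ), h(τ) = θ₄(2τ)θ₄(6τ) satisfy g(τ) = f(τ) + h(τ); that is, θ₃(2τ)θ₃(6τ) = θ₂(2τ)θ₂(6τ) + θ₄(2τ)θ₄(6τ). -/
noncomputable def theta2 (τ : ℂ) : ℂ :=
  ∑' n : ℤ, Complex.exp (Real.pi * Complex.I * ((n : ℂ) + 1/2)^2 * τ)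

noncomputable def theta3 (τ : ℂ) : ℂ :=
  ∑' n : ℤ, Complex.exp (Real.pi * Complex.I * (n : ℂ)^2 * τ)

noncomputable def theta4 (τ : ℂ) : ℂ :=
  ∑' n : ℤ, (-1 : ℂ)^n * Complex.exp (Real.pi * Complex.I * (n : ℂ)^2 * τ)

open Complex in
theorem summable_theta2_term {τ : ℂ} (hτ : 0 < τ.im) :
    Summable fun n : ℤ => exp (Real.pi * I * ((n : ℂ) + 1/2)^2 * τ) := by
  refine (((summable_jacobiTheta₂_term_iff (τ / 2) τ).2 hτ).mul_left
    (exp (Real.pi * I * τ / 4))).congr fun n => ?_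
  rw [jacobiTheta₂_term, ← exp_add]
  ring_nf

open Complex in
theorem summable_theta3_term {τ : ℂ} (hτ : 0 < τ.im) :
    Summable fun n : ℤ => exp (Real.pi * I * (n : ℂ)^2 * τ) := by
  refine ((summable_jacobiTheta₂_term_iff 0 τ).2 hτ).congr fun n => ?_
  rw [jacobiTheta₂_term]
  ring_nf

theorem summable_theta4_term {τ : ℂ} (hτ : 0 < τ.im) :
    Summable fun n : ℤ => (-1 : ℂ)^n * Complex.exp (Real.pi * Complex.I * (n : ℂ)^2 * τ) := by
  refine Summable.of_norm ((summable_theta3_term hτ).norm.congr fun n => ?_)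
  simp

/-- Flipping the sign of `y + 1/2` shows that the alternating part of a sum over a doubly shifted
lattice vanishes. -/
theorem tsum_neg_one_zpow_mul_eq_zero {F : ℤ × ℤ → ℂ} (hF : ∀ x y, F (x, -1 - y) = F (x, y)) :
    ∑' p : ℤ × ℤ, (-1 : ℂ)^(p.1 + p.2) * F p = 0 := by
  have key : ∑' p : ℤ × ℤ, (-1 : ℂ)^(p.1 + p.2) * F p =
      -∑' p : ℤ × ℤ, (-1 : ℂ)^(p.1 + p.2) * F p := by
    rw [← tsum_neg, ← ((Equiv.refl ℤ).prodCongr (Equiv.subLeft (-1))).tsum_eq]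
    refine tsum_congr fun ⟨x, y⟩ => ?_
    have h : (-1 : ℂ)^(x + (-1 - y)) = -(-1 : ℂ)^(x + y) := by
      rw [show x + (-1 - y) = (x + y) + (-1) + 2 * (-y) by ring, zpow_add₀ (by norm_num),
        zpow_add₀ (by norm_num), zpow_mul]
      simp
    simp [hF, h]
  linear_combination key / 2

/-- A sum over the pairs of odd coordinate sum, reindexed by any injection onto those pairs. -/
theorem tsum_one_sub_neg_one_zpow_mul (F : ℤ × ℤ → ℂ) {e : ℤ × ℤ → ℤ × ℤ}
    (he : Function.Injective e) (hodd : ∀ p, Odd ((e p).1 + (e p).2))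
    (hrange : ∀ p : ℤ × ℤ, Odd (p.1 + p.2) → p ∈ Set.range e) :
    ∑' p : ℤ × ℤ, (1 - (-1 : ℂ)^(p.1 + p.2)) * F p = ∑' p, 2 * F (e p) := by
  rw [← he.tsum_eq]
  · refine tsum_congr fun p => ?_
    rw [(hodd p).neg_one_zpow]
    norm_num
  · intro p hp
    refine hrange p (Int.not_even_iff_odd.1 fun h => hp ?_)
    simp [h.neg_one_zpow]

open Complex in
theorem theta_product_sum_identity (τ : ℂ) (hτ : 0 < τ.im) :
    theta3 (2 * τ) * theta3 (6 * τ) =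
      theta2 (2 * τ) * theta2 (6 * τ) + theta4 (2 * τ) * theta4 (6 * τ) := by
  have h2 : 0 < (2 * τ).im := by simpa using hτ
  have h6 : 0 < (6 * τ).im := by simpa using hτ
  obtain ⟨G, hG⟩ : ∃ G : ℤ × ℤ → ℂ, ∀ p, G p =
      exp (Real.pi * I * (p.1 : ℂ)^2 * (2 * τ)) * exp (Real.pi * I * (p.2 : ℂ)^2 * (6 * τ)) :=
    ⟨_, fun _ => rfl⟩
  obtain ⟨F, hF⟩ : ∃ F : ℤ × ℤ → ℂ, ∀ p, F p =
      exp (Real.pi * I * ((p.1 : ℂ) + 1/2)^2 * (2 * τ)) *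
        exp (Real.pi * I * ((p.2 : ℂ) + 1/2)^2 * (6 * τ)) := ⟨_, fun _ => rfl⟩
  have sG : Summable G := (summable_mul_of_summable_norm (summable_theta3_term h2).norm
    (summable_theta3_term h6).norm).congr fun p => (hG p).symm
  have sF : Summable F := (summable_mul_of_summable_norm (summable_theta2_term h2).norm
    (summable_theta2_term h6).norm).congr fun p => (hF p).symm
  have alternating {H : ℤ × ℤ → ℂ} (hH : Summable H) :
      Summable fun p : ℤ × ℤ => (-1 : ℂ)^(p.1 + p.2) * H p :=
    Summable.of_norm (hH.norm.congr fun p => by simp)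
  have e3 : theta3 (2 * τ) * theta3 (6 * τ) = ∑' p, G p := by
    simp only [theta3, hG]
    exact tsum_mul_tsum_of_summable_norm (summable_theta3_term h2).norm
      (summable_theta3_term h6).norm
  have e2 : theta2 (2 * τ) * theta2 (6 * τ) = ∑' p, F p := by
    simp only [theta2, hF]
    exact tsum_mul_tsum_of_summable_norm (summable_theta2_term h2).norm
      (summable_theta2_term h6).norm
  have e4 : theta4 (2 * τ) * theta4 (6 * τ) =
      ∑' p : ℤ × ℤ, (-1 : ℂ)^(p.1 + p.2) * G p := by
    refine (tsum_mul_tsum_of_summable_norm (summable_theta4_term h2).norm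
      (summable_theta4_term h6).norm).trans (tsum_congr fun p => ?_)
    rw [zpow_add₀ (by norm_num), hG]
    ring
  have flip : ∑' p : ℤ × ℤ, (-1 : ℂ)^(p.1 + p.2) * F p = 0 := by
    refine tsum_neg_one_zpow_mul_eq_zero fun x y => ?_
    simp only [hF]
    push_cast
    ring_nf
  have odd_part {H : ℤ × ℤ → ℂ} (hH : Summable H) :
      ∑' p, H p - ∑' p : ℤ × ℤ, (-1 : ℂ)^(p.1 + p.2) * H p =
        ∑' p : ℤ × ℤ, (1 - (-1 : ℂ)^(p.1 + p.2)) * H p := by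
    rw [← hH.tsum_sub (alternating hH)]
    exact tsum_congr fun p => by ring
  have oddG := tsum_one_sub_neg_one_zpow_mul G (e := fun p => (2 * p.1 + p.2 + 1, p.2))
    (fun p q h => by simp only [Prod.mk.injEq] at h; ext <;> lia)
    (fun p => ⟨p.1 + p.2, by ring⟩)
    (fun p ⟨k, hk⟩ => ⟨(k - p.2, p.2), by ext <;> grind⟩)
  have oddF := tsum_one_sub_neg_one_zpow_mul F (e := fun p => (2 * p.2 + p.1, -p.1 - 1))
    (fun p q h => by simp only [Prod.mk.injEq] at h; ext <;> lia)
    (fun p => ⟨p.2 - 1, by ring⟩)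
    (fun p ⟨k, hk⟩ => ⟨(-p.2 - 1, k + 1), by ext <;> grind⟩)
  have norm_eq : ∑' p : ℤ × ℤ, 2 * G (2 * p.1 + p.2 + 1, p.2) =
      ∑' p : ℤ × ℤ, 2 * F (2 * p.2 + p.1, -p.1 - 1) := by
    refine tsum_congr fun p => ?_
    simp only [hG, hF, ← exp_add]
    push_cast
    ring_nf
  rw [e2, e3, e4]
  linear_combination odd_part sG - odd_part sF + oddG - oddF + norm_eq - flip
end

section
/- For every τ in the complex upper half-plane, the following two theta identities hold: θ_{(0,0)}(2τ)·θ_{(2/3,0)}(6τ) = (1/2)·(g(τ/3) − g(τ)) and θ_{(1/2,0)}(2τ)·θ_{(1/6,0)}(6τ) = (1/2)·(f(τ/3) − f(τ)), where f(τ) = θ₂(2τ)θ₂(6τ) and g(τ) = θ₃(2τ)θ₃(6τ). -/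
noncomputable def thetaChar (a : ℝ) (τ : ℂ) : ℂ :=
  ∑' n : ℤ, Complex.exp (Real.pi * Complex.I * ((n : ℂ) + (a : ℂ))^2 * τ)

noncomputable def fProd (τ : ℂ) : ℂ := theta2 (2 * τ) * theta2 (6 * τ)

noncomputable def gProd (τ : ℂ) : ℂ := theta3 (2 * τ) * theta3 (6 * τ)

theorem theta3_eq_thetaChar (τ : ℂ) : theta3 τ = thetaChar 0 τ := by
  simp [theta3, thetaChar]

theorem theta2_eq_thetaChar (τ : ℂ) : theta2 τ = thetaChar (1 / 2) τ := by
  simp [theta2, thetaChar]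

theorem summable_thetaChar (a : ℝ) {τ : ℂ} (hτ : 0 < τ.im) :
    Summable fun n : ℤ ↦ Complex.exp (Real.pi * Complex.I * ((n : ℂ) + (a : ℂ)) ^ 2 * τ) := by
  refine (((summable_jacobiTheta₂_term_iff (a * τ) τ).2 hτ).mul_left
    (Complex.exp (Real.pi * Complex.I * (a : ℂ) ^ 2 * τ))).congr fun n ↦ ?_
  rw [jacobiTheta₂_term, ← Complex.exp_add]
  congr 1
  ring

theorem thetaChar_neg (a : ℝ) (τ : ℂ) : thetaChar (-a) τ = thetaChar a τ := by
  rw [thetaChar, thetaChar, ← (Equiv.neg ℤ).tsum_eq]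
  refine tsum_congr fun n ↦ ?_
  simp only [Equiv.neg_apply]
  push_cast
  ring_nf

theorem thetaChar_add_one (a : ℝ) (τ : ℂ) : thetaChar (a + 1) τ = thetaChar a τ := by
  symm
  rw [thetaChar, thetaChar, ← (Equiv.addRight (1 : ℤ)).tsum_eq]
  refine tsum_congr fun n ↦ ?_
  simp only [Equiv.coe_addRight]
  push_cast
  ring_nf

theorem thetaChar_one_sub (a : ℝ) (τ : ℂ) : thetaChar (1 - a) τ = thetaChar a τ := by
  rw [sub_eq_neg_add, thetaChar_add_one, thetaChar_neg]

/-- Splitting a theta series according to the residue of the summation index modulo `N`. -/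
theorem thetaChar_eq_sum_fin (N : ℕ) [NeZero N] (a : ℝ) {τ : ℂ} (hτ : 0 < τ.im) :
    thetaChar a τ = ∑ j : Fin N, thetaChar ((a + (j : ℕ)) / N) ((N : ℂ) ^ 2 * τ) := by
  have hN : (N : ℂ) ≠ 0 := NeZero.ne _
  have hs := (Int.divModEquiv N).symm.summable_iff.2 (summable_thetaChar a hτ)
  rw [thetaChar, ← (Int.divModEquiv N).symm.tsum_eq, ← (Equiv.prodComm _ _).tsum_eq]
  refine ((Equiv.prodComm _ _).summable_iff.2 hs).tsum_prod.trans ?_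
  rw [tsum_fintype]
  refine Finset.sum_congr rfl fun j _ ↦ tsum_congr fun n ↦ ?_
  simp only [Function.comp_apply, Equiv.prodComm_apply, Prod.swap_prod_mk, Int.divModEquiv_symm_apply]
  push_cast
  congr 1
  field_simp
  ring

theorem theta_char_trisection_identities (τ : ℂ) (hτ : 0 < τ.im) :
    thetaChar 0 (2 * τ) * thetaChar (2 / 3) (6 * τ) =
        (1 / 2) * (gProd (τ / 3) - gProd τ) ∧
    thetaChar (1 / 2) (2 * τ) * thetaChar (1 / 6) (6 * τ) =
        (1 / 2) * (fProd (τ / 3) - fProd τ) := by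
  have h3 : 0 < (2 * (τ / 3)).im := by
    rw [show 2 * (τ / 3) = ((2 / 3 : ℝ) : ℂ) * τ by push_cast; ring, Complex.im_ofReal_mul]
    positivity
  have e2 : 6 * (τ / 3) = 2 * τ := by ring
  have e6 : ((3 : ℕ) : ℂ) ^ 2 * (2 * (τ / 3)) = 6 * τ := by push_cast; ring
  have h0 := thetaChar_eq_sum_fin 3 0 h3
  have h1 := thetaChar_eq_sum_fin 3 (1 / 2) h3
  have r0 := thetaChar_one_sub (2 / 3) (6 * τ)
  have r1 := thetaChar_one_sub (1 / 6) (6 * τ)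
  simp only [Fin.sum_univ_three, e6] at h0 h1
  norm_num at h0 h1 r0 r1
  simp only [fProd, gProd, theta2_eq_thetaChar, theta3_eq_thetaChar, e2]
  norm_num
  constructor
  · rw [h0, r0]
    ring
  · rw [h1, r1]
    ring
end
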